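/- Let G be an infinite countable amenable group. There exists a compact, zero-dimensional metrizable space 𝔛 together with a continuous action of G on 𝔛 which is free (for every g ∈ G with g ≠ e and every x ∈ 𝔛, one has gx ≠ x) and which has topological entropy zero. -/

import Mathlib

open scoped Pointwise symmDiff Classical
open Filter

namespace AmenableTilings

variable {G : Type*}

/-- The left translate `gF` of a finite set `F`. -/
noncomputable def lMul [Group G] (g : G) (F : Finset G) : Finset G := F.image (fun h => g * h)

/-- The right translate `Fg` of a finite set `F`. -/
noncomputable def rMul [Group G] (F : Finset G) (g : G) : Finset G := F.image (fun h => h * g)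

/-- A Følner sequence: a sequence of finite nonempty sets with `|gFₙ Δ Fₙ|/|Fₙ| → 0`
for every `g`. -/
def IsFolnerSeq [Group G] (F : ℕ → Finset G) : Prop :=
  (∀ n, (F n).Nonempty) ∧
  ∀ g : G, Tendsto (fun n => (((lMul g (F n)) ∆ (F n)).card : ℝ) / ((F n).card : ℝ))
    atTop (nhds 0)

/-- A group is amenable if it admits a Følner sequence. -/
def IsAmenable (G : Type*) [Group G] : Prop := ∃ F : ℕ → Finset G, IsFolnerSeq F

/-- `(K,ε)`-invariance: `|KT Δ T| < ε|T|`, where `KT = {gh : g ∈ K, h ∈ T}`. -/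
def KInvariant [Group G] (K T : Finset G) (ε : ℝ) : Prop :=
  (((K * T) ∆ T).card : ℝ) < ε * (T.card : ℝ)

/-- `|S ∩ Fg|`. -/
noncomputable def interCard [Group G] (S : Set G) (F : Finset G) (g : G) : ℕ :=
  ((rMul F g).filter (fun h => h ∈ S)).card

/-- `D̲_F(S) = inf_g |S ∩ Fg| / |F|`. -/
noncomputable def lowerD [Group G] (S : Set G) (F : Finset G) : ℝ :=
  ⨅ g : G, (interCard S F g : ℝ) / (F.card : ℝ)

/-- `D̄_F(S) = sup_g |S ∩ Fg| / |F|`. -/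
noncomputable def upperD [Group G] (S : Set G) (F : Finset G) : ℝ :=
  ⨆ g : G, (interCard S F g : ℝ) / (F.card : ℝ)

/-- Lower Banach density: `sup { D̲_F(S) : F finite nonempty }`. -/
noncomputable def lowerBD [Group G] (S : Set G) : ℝ :=
  sSup {r : ℝ | ∃ F : Finset G, F.Nonempty ∧ r = lowerD S F}

/-- Upper Banach density: `inf { D̄_F(S) : F finite nonempty }`. -/
noncomputable def upperBD [Group G] (S : Set G) : ℝ :=
  sInf {r : ℝ | ∃ F : Finset G, F.Nonempty ∧ r = upperD S F}

/-- The shift action of `G` on `Λ^G`: `(gx)(h) = x(hg)`. -/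
def shift [Group G] {Λ : Type*} (g : G) (x : G → Λ) : G → Λ := fun h => x (h * g)

/-- The orbit closure of `x ∈ Λ^G` under the shift action (with `Λ` discrete and
`Λ^G` carrying the product topology). -/
noncomputable def orbitClosure [Group G] {Λ : Type*} (x : G → Λ) : Set (G → Λ) :=
  @closure _ (@Pi.topologicalSpace G (fun _ => Λ) (fun _ => ⊥)) {y | ∃ g : G, y = shift g x}

/-- `N_X(F)`: the number of blocks with domain `F` occurring in `X`. -/
noncomputable def complexity [Group G] {Λ : Type*} (X : Set (G → Λ)) (F : Finset G) : ℕ :=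
  Set.ncard ((fun x (f : {a // a ∈ F}) => x f.1) '' X)

/-- Topological entropy of a symbolic system:
`inf { (1/|F|) log₂ N_X(F) : F finite nonempty }`. -/
noncomputable def entropyOf [Group G] {Λ : Type*} (X : Set (G → Λ)) : ℝ :=
  sInf {r : ℝ | ∃ F : Finset G, F.Nonempty ∧
    r = Real.logb 2 (complexity X F) / (F.card : ℝ)}

/-- The entropy of (the shift-orbit closure of) a symbolic element. -/
noncomputable def pointEntropy [Group G] {Λ : Type*} (x : G → Λ) : ℝ :=
  entropyOf (orbitClosure x)

/-- A quasitiling of `G`: finitely many finite shapes containing the identity,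
with pairwise disjoint center sets, such that the map `(S,c) ↦ Sc` is injective. -/
structure Quasitiling (G : Type*) [Group G] where
  shapes : Finset (Finset G)
  centers : Finset G → Set G
  one_mem : ∀ S ∈ shapes, (1 : G) ∈ S
  centers_empty : ∀ S, S ∉ shapes → centers S = ∅
  centers_disjoint : ∀ S ∈ shapes, ∀ S' ∈ shapes, S ≠ S' → Disjoint (centers S) (centers S')
  tiles_inj : ∀ S ∈ shapes, ∀ S' ∈ shapes, ∀ c ∈ centers S, ∀ c' ∈ centers S',
    rMul S c = rMul S' c' → S = S' ∧ c = c'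

namespace Quasitiling

variable [Group G]

/-- `(S,c)` is a tile of the quasitiling. -/
def IsTile (𝒯 : Quasitiling G) (S : Finset G) (c : G) : Prop :=
  S ∈ 𝒯.shapes ∧ c ∈ 𝒯.centers S

/-- The union of all tiles of the quasitiling. -/
def union (𝒯 : Quasitiling G) : Set G :=
  ⋃ S ∈ 𝒯.shapes, ⋃ c ∈ 𝒯.centers S, (↑(rMul S c) : Set G)

/-- `f` witnesses `ε`-disjointness: it assigns to each tile a `(1-ε)`-subset, and the
assigned subsets of distinct tiles are pairwise disjoint. -/
def EpsDisjointWith (𝒯 : Quasitiling G) (ε : ℝ) (f : Finset G → G → Finset G) : Prop :=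
  (∀ S c, 𝒯.IsTile S c →
    f S c ⊆ rMul S c ∧ (1 - ε) * (S.card : ℝ) ≤ ((f S c).card : ℝ)) ∧
  (∀ S c S' c', 𝒯.IsTile S c → 𝒯.IsTile S' c' → (S, c) ≠ (S', c') →
    Disjoint (f S c) (f S' c'))

/-- `ε`-disjointness of a quasitiling. -/
def EpsDisjoint (𝒯 : Quasitiling G) (ε : ℝ) : Prop := ∃ f, 𝒯.EpsDisjointWith ε f

/-- The tiles are pairwise disjoint. -/
def TilesDisjoint (𝒯 : Quasitiling G) : Prop :=
  ∀ S c S' c', 𝒯.IsTile S c → 𝒯.IsTile S' c' → (S, c) ≠ (S', c') →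
    Disjoint (rMul S c) (rMul S' c')

/-- `α`-covering: the union of the tiles has lower Banach density at least `α`. -/
def Covering (𝒯 : Quasitiling G) (α : ℝ) : Prop := α ≤ lowerBD 𝒯.union

/-- An exact tiling: the tiles form a partition of `G`. -/
def IsExactTiling (𝒯 : Quasitiling G) : Prop := 𝒯.TilesDisjoint ∧ 𝒯.union = Set.univ

/-- The symbolic representation `x_𝒯` of a quasitiling, over the alphabet
`𝒮(𝒯) ∪ {0}` (encoded as `Option (Finset G)`, with `none` playing the role of `0`):
`x_𝒯(g) = S` iff `g ∈ C(S)`. -/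
noncomputable def symb (𝒯 : Quasitiling G) : G → Option (Finset G) :=
  fun g => if h : ∃ S, S ∈ 𝒯.shapes ∧ g ∈ 𝒯.centers S then some h.choose else none

/-- The entropy of a quasitiling: the topological entropy of the shift-orbit closure of
its symbolic representation. -/
noncomputable def entropy (𝒯 : Quasitiling G) : ℝ := pointEntropy 𝒯.symb

end Quasitiling

/-- `𝒯'` is congruent with `𝒯` (each tile of `𝒯'` is a union of tiles of `𝒯`). -/
def Congruent [Group G] (𝒯 𝒯' : Quasitiling G) : Prop :=
  ∀ S c, 𝒯'.IsTile S c → ∃ P : Set (Finset G × G),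
    (∀ p ∈ P, 𝒯.IsTile p.1 p.2) ∧
    (↑(rMul S c) : Set G) = ⋃ p ∈ P, (↑(rMul p.1 p.2) : Set G)

/-- The union over all tiles `(S,c)` of the assigned subsets `f S c`. -/
def subUnion [Group G] (𝒯 : Quasitiling G) (f : Finset G → G → Finset G) : Set G :=
  ⋃ S ∈ 𝒯.shapes, ⋃ c ∈ 𝒯.centers S, (↑(f S c) : Set G)

end AmenableTilings
namespace AmenableTilings

/-- A label outside `S`, if there is one. -/
noncomputable def freshLabel {n : ℕ} (S : Set (Fin n)) : Option (Fin n) :=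
  if h : ∃ a, a ∉ S then some h.choose else none

lemma freshLabel_notMem {n : ℕ} {S : Set (Fin n)} {a : Fin n} (h : freshLabel S = some a) :
    a ∉ S := by
  unfold freshLabel at h
  split_ifs at h with h'
  rw [← Option.some_injective _ h]
  exact h'.choose_spec

lemma freshLabel_ne_none {n : ℕ} {S : Set (Fin n)} (h : ∃ a, a ∉ S) : freshLabel S ≠ none := by
  simp [freshLabel, h]

/-- Process the elements of `H` in the order of their colours `x`: an element becomes a labelled
centre unless one of its earlier `D`-neighbours is a centre, and its label differs from those of
its earlier `E`-neighbours. -/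
noncomputable def greedy {H : Type*} [Group H] (D E : Finset H) (n : ℕ) (x : H → ℕ) (h : H) :
    Option (Fin n) :=
  freshLabel {a | (∃ d ∈ D, ∃ _ : x (d * h) < x h, greedy D E n x (d * h) ≠ none) ∨
    ∃ e ∈ E, ∃ _ : x (e * h) < x h, greedy D E n x (e * h) = some a}
termination_by x h
decreasing_by all_goals assumption

lemma greedy_local {H : Type*} [Group H] (D E : Finset H) (n N : ℕ) :
    ∃ W : Finset H, ∀ (x x' : H → ℕ) (h h' : H), x h < N →
      (∀ w ∈ W, x (w * h) = x' (w * h')) → greedy D E n x h = greedy D E n x' h' := by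
  induction N with
  | zero => exact ⟨∅, fun x x' h h' hx => absurd hx (Nat.not_lt_zero _)⟩
  | succ N ih =>
    obtain ⟨W, hW⟩ := ih
    refine ⟨insert 1 ((D ∪ E) ∪ W * (D ∪ E)), fun x x' h h' hx hxx => ?_⟩
    have h1 : x h = x' h' := by simpa using hxx 1 (by simp)
    have h2 : ∀ e ∈ D ∪ E, x (e * h) = x' (e * h') := fun e he =>
      hxx e (Finset.mem_insert_of_mem (Finset.mem_union_left _ he))
    have h3 : ∀ e ∈ D ∪ E, x (e * h) < x h →
        greedy D E n x (e * h) = greedy D E n x' (e * h') := fun e he hlt =>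
      hW x x' _ _ (by omega) fun w hw => by
        rw [← mul_assoc, ← mul_assoc]
        exact hxx _ (Finset.mem_insert_of_mem
          (Finset.mem_union_right _ (Finset.mul_mem_mul hw he)))
    have h4 : (∃ d ∈ D, ∃ _ : x (d * h) < x h, greedy D E n x (d * h) ≠ none) ↔
        (∃ d ∈ D, ∃ _ : x' (d * h') < x' h', greedy D E n x' (d * h') ≠ none) := by
      refine exists_congr fun d => and_congr_right fun hd => ?_
      have hd' := Finset.mem_union_left E hd
      rw [← h2 d hd', ← h1]
      exact exists_congr fun hlt => by rw [h3 d hd' hlt]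
    have h5 : {a | ∃ e ∈ E, ∃ _ : x (e * h) < x h, greedy D E n x (e * h) = some a} =
        {a | ∃ e ∈ E, ∃ _ : x' (e * h') < x' h', greedy D E n x' (e * h') = some a} := by
      ext a
      refine exists_congr fun d => and_congr_right fun hd => ?_
      have hd' := Finset.mem_union_right D hd
      rw [← h2 d hd', ← h1]
      exact exists_congr fun hlt => by rw [h3 d hd' hlt]
    rw [greedy, greedy.eq_def D E n x' h', Set.ofPred_or, Set.ofPred_or, h5]
    simp only [h4]

/-- The set of centres of `y` is maximal `D`-separated, and `E`-neighbouring centres carry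
different labels. -/
structure IsMarking {H : Type*} [Group H] (D E : Finset H) {n : ℕ} (y : H → Option (Fin n)) :
    Prop where
  separated : ∀ h, ∀ d ∈ D, d ≠ 1 → y h ≠ none → y (d * h) = none
  syndetic : ∀ h, ∃ d ∈ D, y (d * h) ≠ none
  proper : ∀ h, ∀ e ∈ E, y h ≠ none → y (e * h) ≠ y h

lemma greedy_isMarking {H : Type*} [Group H] {D E : Finset H} {n : ℕ} (hn : E.card < n)
    (h1D : 1 ∈ D) (hD : ∀ d ∈ D, d⁻¹ ∈ D) (hE : ∀ e ∈ E, e⁻¹ ∈ E)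
    (hDE : ∀ d ∈ D, d ≠ 1 → d ∈ E) {x : H → ℕ} (hx : ∀ h, ∀ e ∈ E, x (e * h) ≠ x h) :
    IsMarking D E (greedy D E n x) := by
  have key : ∀ h, (∃ d ∈ D, x (d * h) < x h ∧ greedy D E n x (d * h) ≠ none) →
      greedy D E n x h = none := fun h hh => by
    rw [greedy]
    simp only [exists_prop, hh, true_or]
    simp [freshLabel]
  have key2 : ∀ h, ¬ (∃ d ∈ D, x (d * h) < x h ∧ greedy D E n x (d * h) ≠ none) →
      greedy D E n x h =
        freshLabel {a | ∃ e ∈ E, x (e * h) < x h ∧ greedy D E n x (e * h) = some a} :=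
    fun h hh => by
      rw [greedy]
      simp only [exists_prop, hh, false_or]
  refine ⟨fun h d hd hd1 hy => ?_, fun h => ?_, fun h e he hy heq => ?_⟩
  · by_contra hy'
    rcases lt_or_gt_of_ne (hx h d (hDE d hd hd1)) with hlt | hlt
    · exact hy (key h ⟨d, hd, hlt, hy'⟩)
    · exact hy' (key _ ⟨d⁻¹, hD d hd, by simpa using hlt, by simpa using hy⟩)
  · by_cases hh : ∃ d ∈ D, x (d * h) < x h ∧ greedy D E n x (d * h) ≠ none
    · obtain ⟨d, hd, -, hd'⟩ := hh
      exact ⟨d, hd, hd'⟩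
    · refine ⟨1, h1D, ?_⟩
      rw [one_mul, key2 h hh]
      refine freshLabel_ne_none ?_
      by_contra! hall
      have : (Finset.univ : Finset (Option (Fin n))).erase none ⊆
          E.image fun e => greedy D E n x (e * h) := by
        intro a ha
        rcases a with _ | a
        · simp at ha
        · obtain ⟨e, he, -, h'⟩ := hall a
          exact Finset.mem_image.2 ⟨e, he, h'⟩
      have := (Finset.card_le_card this).trans Finset.card_image_le
      simp at this
      omega
  · have main : ∀ h, ∀ e ∈ E, greedy D E n x h ≠ none → x (e * h) < x h →
        greedy D E n x (e * h) ≠ greedy D E n x h := by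
      intro h e he hy hlt heq
      obtain ⟨a, ha⟩ := Option.ne_none_iff_exists'.1 hy
      have h' : ¬ ∃ d ∈ D, x (d * h) < x h ∧ greedy D E n x (d * h) ≠ none :=
        fun hh => hy (key h hh)
      have := freshLabel_notMem ((key2 h h').symm.trans ha)
      exact this ⟨e, he, hlt, heq.trans ha⟩
    rcases lt_or_gt_of_ne (hx h e he) with hlt | hlt
    · exact main h e he hy hlt heq
    · exact main (e * h) e⁻¹ (hE e he) (heq ▸ hy) (by simpa using hlt) (by simpa using heq.symm)

lemma IsMarking.shift {H : Type*} [Group H] {D E : Finset H} {n : ℕ} {y : H → Option (Fin n)}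
    (hy : IsMarking D E y) (g : H) : IsMarking D E fun h => y (h * g) where
  separated h d hd hd1 hh := by simpa [mul_assoc] using hy.separated (h * g) d hd hd1 hh
  syndetic h := by simpa [mul_assoc] using hy.syndetic (h * g)
  proper h e he hh := by simpa [mul_assoc] using hy.proper (h * g) e he hh

lemma IsMarking.of_locally {H : Type*} [Group H] {D E : Finset H} {n : ℕ}
    {y : H → Option (Fin n)}
    (hy : ∀ F : Finset H, ∃ y', IsMarking D E y' ∧ ∀ h ∈ F, y h = y' h) : IsMarking D E y where
  separated h d hd hd1 hh := by
    obtain ⟨y', hy', hF⟩ := hy {h, d * h}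
    rw [hF _ (by simp)] at hh ⊢
    exact hy'.separated h d hd hd1 hh
  syndetic h := by
    obtain ⟨y', hy', hF⟩ := hy (D.image (· * h))
    obtain ⟨d, hd, hd'⟩ := hy'.syndetic h
    exact ⟨d, hd, by rwa [hF _ (Finset.mem_image_of_mem (· * h) hd)]⟩
  proper h e he hh := by
    obtain ⟨y', hy', hF⟩ := hy {h, e * h}
    rw [hF h (by simp)] at hh ⊢
    rw [hF _ (by simp)]
    exact hy'.proper h e he hh

/-- Conjugates of `E` by `D'` lying in `E'` make the `D'`-windows of a marking a proper colouring
for `E`. -/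
lemma IsMarking.exists_window_ne {H : Type*} [Group H] {D' E' E : Finset H} {n : ℕ}
    {y : H → Option (Fin n)} (hy : IsMarking D' E' y)
    (hE : ∀ d ∈ D', ∀ e ∈ E, d * e * d⁻¹ ∈ E') (h : H) {e : H} (he : e ∈ E) :
    ∃ d ∈ D', y (d * (e * h)) ≠ y (d * h) := by
  obtain ⟨d, hd, hd'⟩ := hy.syndetic h
  refine ⟨d, hd, ?_⟩
  simpa [mul_assoc] using hy.proper (d * h) _ (hE d hd e he) hd'

/-- Recompute a coarse marking from a finer one, greedily and by a finite rule. -/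
lemma exists_marking_map {H : Type*} [Group H] {D E D' E' : Finset H} {n n' : ℕ}
    (hn : E.card < n) (h1D : 1 ∈ D) (hD : ∀ d ∈ D, d⁻¹ ∈ D) (hE : ∀ e ∈ E, e⁻¹ ∈ E)
    (hDE : ∀ d ∈ D, d ≠ 1 → d ∈ E) (hEE' : ∀ d ∈ D', ∀ e ∈ E, d * e * d⁻¹ ∈ E') :
    ∃ Φ : (H → Option (Fin n')) → H → Option (Fin n),
      (∀ y, IsMarking D' E' y → IsMarking D E (Φ y)) ∧
      (∃ W : Finset H, ∀ y y' h h', (∀ w ∈ W, y (w * h) = y' (w * h')) → Φ y h = Φ y' h') := by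
  obtain ⟨m, ⟨code⟩⟩ := Finite.exists_equiv_fin (D' → Option (Fin n'))
  let x : (H → Option (Fin n')) → H → ℕ := fun y h => code fun d => y (d * h)
  obtain ⟨W, hW⟩ := greedy_local D E n m
  refine ⟨fun y => greedy D E n (x y), fun y hy => ?_, D' * W, fun y y' h h' hyy => ?_⟩
  · refine greedy_isMarking hn h1D hD hE hDE fun h e he heq => ?_
    obtain ⟨d, hd, hne⟩ := hy.exists_window_ne hEE' h he
    exact hne (congrFun (code.injective (Fin.ext heq)) ⟨d, hd⟩)
  · refine hW _ _ h h' (code _).2 fun w hw => ?_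
    refine congrArg (fun f => (code f : ℕ)) (funext fun d => ?_)
    simpa [mul_assoc] using hyy _ (Finset.mul_mem_mul d.2 hw)

/-- Sequences of configurations, one on each level, satisfying `P` and linked by the maps `Φ`. -/
def linkedSequences {H : Type*} {A : ℕ → Type*} (P : ∀ k, (H → A k) → Prop)
    (Φ : ∀ k, (H → A (k + 1)) → H → A k) : Set (∀ p : ℕ × H, A p.1) :=
  {z | (∀ k, P k fun h => z (k, h)) ∧ ∀ k h, z (k, h) = Φ k (fun h' => z (k + 1, h')) h}

lemma exists_linked_upTo {H : Type*} {A : ℕ → Type*} {P : ∀ k, (H → A k) → Prop}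
    {Φ : ∀ k, (H → A (k + 1)) → H → A k} (hΦP : ∀ k y, P (k + 1) y → P k (Φ k y))
    (hne : ∀ k, ∃ y, P k y) (n : ℕ) :
    ∀ y, P n y → ∃ z : ∀ k, H → A k, z n = y ∧ (∀ k ≤ n, P k (z k)) ∧
      ∀ k < n, z k = Φ k (z (k + 1)) := by
  induction n with
  | zero =>
    intro y hy
    choose z hz using hne
    refine ⟨Function.update z 0 y, by simp, fun k hk => ?_, by simp⟩
    obtain rfl : k = 0 := by omega
    simpa using hy
  | succ n ih =>
    intro y hy
    obtain ⟨z, hz, hP, hl⟩ := ih _ (hΦP n y hy)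
    refine ⟨Function.update z (n + 1) y, by simp, fun k hk => ?_, fun k hk => ?_⟩
    · rcases eq_or_lt_of_le hk with rfl | hk
      · simpa using hy
      · rw [Function.update_of_ne (by omega)]
        exact hP k (by omega)
    · rcases eq_or_lt_of_le (Nat.lt_succ_iff.1 hk) with rfl | hk'
      · rw [Function.update_of_ne (by omega), hz]
        simp
      · rw [Function.update_of_ne (by omega), Function.update_of_ne (by omega)]
        exact hl k hk'

lemma level_congr {H : Type*} {A : ℕ → Type*} (z : ∀ p : ℕ × H, A p.1) (k : ℕ) {a b : H}
    (h : a = b) : z (k, a) = z (k, b) := by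
  subst h
  rfl

section LinkedSequences

variable {H : Type*} [Group H] {A : ℕ → Type*} {P : ∀ k, (H → A k) → Prop}
  {Φ : ∀ k, (H → A (k + 1)) → H → A k}

lemma mem_linkedSequences_of_locally
    (hloc : ∀ k y, (∀ F : Finset H, ∃ y', P k y' ∧ ∀ h ∈ F, y h = y' h) → P k y)
    (hΦ : ∀ k, ∃ W : Finset H, ∀ y y' h h', (∀ w ∈ W, y (w * h) = y' (w * h')) →
      Φ k y h = Φ k y' h') {z : ∀ p : ℕ × H, A p.1}
    (hz : ∀ n, ∀ F : Finset (ℕ × H), ∃ z' : ∀ p : ℕ × H, A p.1,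
      (∀ k ≤ n, P k fun h => z' (k, h)) ∧
      (∀ k < n, ∀ h, z' (k, h) = Φ k (fun h' => z' (k + 1, h')) h) ∧ ∀ p ∈ F, z p = z' p) :
    z ∈ linkedSequences P Φ := by
  refine ⟨fun k => hloc k _ fun F => ?_, fun k h => ?_⟩
  · obtain ⟨z', hP, -, hF⟩ := hz k (F.image (Prod.mk k))
    exact ⟨_, hP k le_rfl, fun h hh => hF _ (Finset.mem_image_of_mem _ hh)⟩
  · obtain ⟨W, hW⟩ := hΦ k
    obtain ⟨z', -, hl, hF⟩ := hz (k + 1) (insert (k, h) (W.image fun w => (k + 1, w * h)))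
    rw [hF _ (by simp), hl k (by omega) h]
    exact (hW _ _ h h fun w hw => hF _ (Finset.mem_insert_of_mem
      (Finset.mem_image_of_mem (fun w => (k + 1, w * h)) hw))).symm

lemma shift_mem_linkedSequences (hshift : ∀ k y g, P k y → P k fun h => y (h * g))
    (hΦ : ∀ k, ∃ W : Finset H, ∀ y y' h h', (∀ w ∈ W, y (w * h) = y' (w * h')) →
      Φ k y h = Φ k y' h') {z : ∀ p : ℕ × H, A p.1} (hz : z ∈ linkedSequences P Φ) (g : H) :
    (fun p => z (p.1, p.2 * g) : ∀ p : ℕ × H, A p.1) ∈ linkedSequences P Φ := by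
  refine ⟨fun k => hshift k _ g (hz.1 k), fun k h => ?_⟩
  obtain ⟨W, hW⟩ := hΦ k
  exact (hz.2 k (h * g)).trans (hW _ _ _ _ fun w _ =>
    level_congr z (k + 1) (mul_assoc w h g).symm)

/-- A coordinate of a linked sequence is determined by a finite window on any higher level. -/
lemma exists_window
    (hΦ : ∀ k, ∃ W : Finset H, ∀ y y' h h', (∀ w ∈ W, y (w * h) = y' (w * h')) →
      Φ k y h = Φ k y' h') (I : Finset (ℕ × H)) (n : ℕ) (hI : ∀ p ∈ I, p.1 ≤ n) :
    ∃ W : Finset H, ∀ z ∈ linkedSequences P Φ, ∀ z' ∈ linkedSequences P Φ,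
      (∀ w ∈ W, z (n, w) = z' (n, w)) → ∀ p ∈ I, z p = z' p := by
  have single : ∀ p : ℕ × H, ∀ k ≥ p.1, ∃ W : Finset H, ∀ z ∈ linkedSequences P Φ,
      ∀ z' ∈ linkedSequences P Φ, (∀ w ∈ W, z (k, w) = z' (k, w)) → z p = z' p := by
    intro p k hk
    induction k, hk using Nat.le_induction with
    | base => exact ⟨{p.2}, fun z _ z' _ h => h p.2 (by simp)⟩
    | succ k _ ih =>
      obtain ⟨W, hW⟩ := ih
      obtain ⟨V, hV⟩ := hΦ k
      refine ⟨V * W, fun z hz z' hz' h => hW z hz z' hz' fun w hw => ?_⟩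
      rw [hz.2, hz'.2]
      exact hV _ _ _ _ fun v hv => h _ (Finset.mul_mem_mul hv hw)
  choose! W hW using single
  exact ⟨I.biUnion fun p => W p n, fun z hz z' hz' h p hp => hW p n (hI p hp) z hz z' hz'
    fun w hw => h w (Finset.mem_biUnion.2 ⟨p, hp, hw⟩)⟩

end LinkedSequences

/-- A set of sequences over discrete alphabets which is determined locally is closed. -/
lemma isClosed_of_locally {ι : Type*} {A : ι → Type*} [∀ i, TopologicalSpace (A i)]
    [∀ i, DiscreteTopology (A i)] {S : Set (∀ i, A i)}
    (hS : ∀ z, (∀ F : Finset ι, ∃ z' ∈ S, ∀ i ∈ F, z i = z' i) → z ∈ S) : IsClosed S := by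
  refine isClosed_of_closure_subset fun z hz => hS z fun F => ?_
  obtain ⟨z', hz', hS'⟩ := mem_closure_iff.1 hz ((F : Set ι).pi fun i => {z i})
    (isOpen_set_pi F.finite_toSet fun i _ => isOpen_discrete _) (by simp)
  exact ⟨z', hS', fun i hi => (hz' i hi).symm⟩

lemma linkedSequences_nonempty {H : Type*} [Group H] {A : ℕ → Type*} [∀ k, Finite (A k)]
    {P : ∀ k, (H → A k) → Prop} {Φ : ∀ k, (H → A (k + 1)) → H → A k}
    (hΦP : ∀ k y, P (k + 1) y → P k (Φ k y)) (hne : ∀ k, ∃ y, P k y)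
    (hloc : ∀ k y, (∀ F : Finset H, ∃ y', P k y' ∧ ∀ h ∈ F, y h = y' h) → P k y)
    (hΦ : ∀ k, ∃ W : Finset H, ∀ y y' h h', (∀ w ∈ W, y (w * h) = y' (w * h')) →
      Φ k y h = Φ k y' h') : (linkedSequences P Φ).Nonempty := by
  let _ : ∀ k, TopologicalSpace (A k) := fun _ => ⊥
  have : ∀ k, DiscreteTopology (A k) := fun _ => ⟨rfl⟩
  let S : ℕ → Set (∀ p : ℕ × H, A p.1) := fun n => {z | (∀ k ≤ n, P k fun h => z (k, h)) ∧
    ∀ k < n, ∀ h, z (k, h) = Φ k (fun h' => z (k + 1, h')) h}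
  obtain ⟨z, hz⟩ := IsCompact.nonempty_iInter_of_sequence_nonempty_isCompact_isClosed
    (fun n => closure (S n))
    (fun n => closure_mono fun z hz => ⟨fun k hk => hz.1 k (by omega),
      fun k hk => hz.2 k (by omega)⟩)
    (fun n => by
      obtain ⟨y, hy⟩ := hne n
      obtain ⟨z, -, hP, hl⟩ := exists_linked_upTo hΦP hne n y hy
      exact ⟨fun p => z p.1 p.2, subset_closure ⟨hP, fun k hk h => congrFun (hl k hk) h⟩⟩)
    isClosed_closure.isCompact (fun n => isClosed_closure)
  refine ⟨z, mem_linkedSequences_of_locally hloc hΦ fun n F => ?_⟩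
  obtain ⟨z', hz', hS'⟩ := mem_closure_iff.1 (Set.mem_iInter.1 hz n)
    ((F : Set (ℕ × H)).pi fun i => {z i})
    (isOpen_set_pi F.finite_toSet fun i _ => isOpen_discrete _) (by simp)
  exact ⟨z', hS'.1, hS'.2, fun p hp => (hz' p hp).symm⟩

/-- The linked sequences form a free zero-dimensional action whose entropy is controlled by the
number of patterns on high levels. -/
theorem exists_free_action_of_levels {H : Type} [Group H] [Countable H] {A : ℕ → Type}
    [∀ k, Finite (A k)] {P : ∀ k, (H → A k) → Prop} {Φ : ∀ k, (H → A (k + 1)) → H → A k}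
    (hΦP : ∀ k y, P (k + 1) y → P k (Φ k y)) (hne : ∀ k, ∃ y, P k y)
    (hloc : ∀ k y, (∀ F : Finset H, ∃ y', P k y' ∧ ∀ h ∈ F, y h = y' h) → P k y)
    (hΦ : ∀ k, ∃ W : Finset H, ∀ y y' h h', (∀ w ∈ W, y (w * h) = y' (w * h')) →
      Φ k y h = Φ k y' h')
    (hshift : ∀ k y g, P k y → P k fun h => y (h * g))
    (hfree : ∀ g ≠ 1, ∃ k, ∀ y, P k y → (fun h => y (h * g)) ≠ y)
    (hcount : ∀ δ > 0, ∃ k₀, ∀ k ≥ k₀, ∃ K : Finset H, ∀ F : Finset H,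
      Real.log (Set.ncard ((fun y (f : F) => y f) '' {y | P k y})) ≤ δ * (K * F).card) :
    ∃ (X : Type) (_ : MetricSpace X) (_ : CompactSpace X) (act : H → X → X),
      Nonempty X ∧
      (∃ Bs : Set (Set X), (∀ U ∈ Bs, IsClopen U) ∧ TopologicalSpace.IsTopologicalBasis Bs) ∧
      (∀ g : H, Continuous (act g)) ∧
      (∀ x : X, act 1 x = x) ∧
      (∀ g h : H, ∀ x : X, act (g * h) x = act g (act h x)) ∧
      (∀ g : H, g ≠ 1 → ∀ x : X, act g x ≠ x) ∧
      ∀ ε > 0, ∀ δ > 0, ∃ B : Finset H, ∀ F : Finset H, ∀ E : Finset X,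
        (∀ x ∈ E, ∀ y ∈ E, x ≠ y → ∃ g ∈ F, ε < dist (act g x) (act g y)) →
          Real.log E.card ≤ δ * (B * F).card := by
  let _ : ∀ k, UniformSpace (A k) := fun _ => ⊥
  have : ∀ k, DiscreteUniformity (A k) := fun _ => ⟨rfl⟩
  have : ∀ k, IsCountablyGenerated (uniformity (A k)) := fun k => by
    rw [DiscreteUniformity.eq_principal_setRelId]
    infer_instance
  have hclosed : IsClosed (linkedSequences P Φ) := isClosed_of_locally fun z hz =>
    mem_linkedSequences_of_locally hloc hΦ fun n F =>
      let ⟨z', hz', hF⟩ := hz F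
      ⟨z', fun k _ => hz'.1 k, fun k _ => hz'.2 k, hF⟩
  have : CompactSpace (linkedSequences P Φ) := isCompact_iff_compactSpace.1 hclosed.isCompact
  let _ : MetricSpace (linkedSequences P Φ) := UniformSpace.metricSpace _
  have hdist : ∀ ε > 0, ∃ I : Finset (ℕ × H), ∀ z z' : linkedSequences P Φ,
      (∀ p ∈ I, z.1 p = z'.1 p) → dist z z' ≤ ε := by
    intro ε hε
    have hmem := Metric.dist_mem_uniformity (α := linkedSequences P Φ) hε
    change _ ∈ uniformity (Subtype (· ∈ linkedSequences P Φ)) at hmem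
    rw [uniformity_subtype] at hmem
    obtain ⟨t, ht, hsub⟩ := Filter.mem_comap.1 hmem
    rw [Pi.uniformity, Filter.mem_iInf] at ht
    obtain ⟨I, hI, V, hV, rfl⟩ := ht
    refine ⟨hI.toFinset, fun z z' hz => ?_⟩
    refine le_of_lt (hsub (a := (z, z')) ?_)
    refine Set.mem_iInter.2 fun i => ?_
    obtain ⟨u, hu, huV⟩ := hV i
    refine huV ?_
    have := hz i (by simp)
    simpa [this] using refl_mem_uniformity hu
  refine ⟨linkedSequences P Φ, inferInstance, inferInstance,
    fun g z => ⟨_, shift_mem_linkedSequences hshift hΦ z.2 g⟩,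
    (linkedSequences_nonempty hΦP hne hloc hΦ).to_subtype,
    ⟨_, fun U hU => hU, isTopologicalBasis_isClopen⟩, fun g => ?_, fun z => ?_, fun g h z => ?_,
    fun g hg z hz => ?_, fun ε hε δ hδ => ?_⟩
  · exact (continuous_pi fun p => (continuous_apply (p.1, p.2 * g)).comp
      continuous_subtype_val).subtype_mk _
  · exact Subtype.ext (funext fun p => level_congr z.1 p.1 (mul_one p.2))
  · exact Subtype.ext (funext fun p =>
      level_congr z.1 p.1 (mul_assoc p.2 g h).symm)
  · obtain ⟨k, hk⟩ := hfree g hg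
    exact hk _ (z.2.1 k) (funext fun h => congrFun (congrArg Subtype.val hz) (k, h))
  · obtain ⟨I, hI⟩ := hdist ε hε
    obtain ⟨k₀, hk₀⟩ := hcount δ hδ
    let n := max k₀ (I.sup Prod.fst)
    obtain ⟨K, hK⟩ := hk₀ n (le_max_left _ _)
    obtain ⟨W, hW⟩ := exists_window (P := P) (Φ := Φ) hΦ I n
      fun p hp => (Finset.le_sup (f := Prod.fst) hp).trans (le_max_right _ _)
    refine ⟨K * W, fun F E hE => ?_⟩
    rw [mul_assoc]
    rcases E.eq_empty_or_nonempty with rfl | hne'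
    · simpa using by positivity
    refine (Real.log_le_log (by simpa using hne') ?_).trans (hK (W * F))
    rw [Nat.cast_le, ← Set.ncard_coe_finset E]
    refine Set.ncard_le_ncard_of_injOn
      (fun (z : linkedSequences P Φ) (f : ↥(W * F)) => z.1 (n, f)) (fun z hz => ⟨_, z.2.1 n, rfl⟩)
      (fun z hz z' hz' heq => ?_) (Set.toFinite _)
    by_contra hzz
    obtain ⟨g, hg, hlt⟩ := hE z hz z' hz' hzz
    refine absurd (hI _ _ ?_) (not_le.2 hlt)
    exact hW _ (shift_mem_linkedSequences hshift hΦ z.2 g) _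
      (shift_mem_linkedSequences hshift hΦ z'.2 g) fun w hw =>
        congrFun heq ⟨w * g, Finset.mul_mem_mul hw hg⟩

lemma IsMarking.card_mul_card_le {H : Type*} [Group H] {K E : Finset H} {n : ℕ}
    {y : H → Option (Fin n)} (hy : IsMarking (K⁻¹ * K) E y) (F : Finset H) :
    K.card * (Finset.univ.filter fun f : F => y f ≠ none).card ≤ (K * F).card := by
  rw [← Finset.card_product]
  refine Finset.card_le_card_of_injOn (fun p => p.1 * (p.2 : H)) (fun p hp => ?_)
    fun p hp q hq hpq => ?_
  · exact Finset.mul_mem_mul (Finset.mem_product.1 hp).1 p.2.2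
  · simp only [Finset.coe_product, Set.mem_prod, Finset.mem_coe, Finset.mem_filter,
      Finset.mem_univ, true_and] at hp hq hpq
    have h2 : (p.2 : H) = q.2 := by
      by_contra hne
      have hqp : (q.1⁻¹ * p.1) * (p.2 : H) = q.2 := by rw [mul_assoc, hpq]; simp
      refine hq.2 (hqp ▸ hy.separated p.2 (q.1⁻¹ * p.1)
        (Finset.mul_mem_mul (Finset.inv_mem_inv hq.1) hp.1) (fun h1 => hne ?_) hp.2)
      rw [← hqp, h1, one_mul]
    have h1 : p.1 = q.1 := by
      rw [h2] at hpq
      exact mul_right_cancel hpq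
    exact Prod.ext h1 (Subtype.ext h2)

/-- Weighted count of sparse patterns: each nonempty symbol costs a factor `exp a`. -/
lemma card_sparse_le {ι : Type*} [Fintype ι] {n : ℕ} (S : Finset (ι → Option (Fin n)))
    {a b : ℝ} (ha : 0 ≤ a)
    (hS : ∀ f ∈ S, ((Finset.univ.filter fun i => f i ≠ none).card : ℝ) ≤ b) :
    (S.card : ℝ) ≤ Real.exp (a * b) * (1 + n * Real.exp (-a)) ^ Fintype.card ι := by
  let w : Option (Fin n) → ℝ := fun o => if o ≠ none then Real.exp (-a) else 1
  have hw : ∀ f : ι → Option (Fin n), ∏ i, w (f i) =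
      Real.exp (-a * (Finset.univ.filter fun i => f i ≠ none).card) := fun f => by
    rw [Finset.prod_ite]
    simp [← Real.exp_nat_mul, mul_comm]
  have htot : ∑ f : ι → Option (Fin n), ∏ i, w (f i) =
      (1 + n * Real.exp (-a)) ^ Fintype.card ι := by
    rw [← Fintype.prod_sum (fun _ : ι => w)]
    simp [w, Fintype.sum_option]
  have hlow : (S.card : ℝ) * Real.exp (-(a * b)) ≤ ∑ f : ι → Option (Fin n), ∏ i, w (f i) := by
    rw [← nsmul_eq_mul]
    refine (Finset.card_nsmul_le_sum S _ _ fun f hf => ?_).trans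
      (Finset.sum_le_sum_of_subset_of_nonneg (Finset.subset_univ S) fun f _ _ => ?_)
    · rw [hw, Real.exp_le_exp]
      nlinarith [hS f hf]
    · rw [hw]
      positivity
  rw [htot, Real.exp_neg, ← div_eq_mul_inv, div_le_iff₀ (Real.exp_pos _)] at hlow
  linarith

lemma log_patterns_le {H : Type*} [Group H] {K E : Finset H} (hK : K.Nonempty) {n : ℕ}
    (hn : 0 < n) (F : Finset H) :
    Real.log (Set.ncard ((fun (y : H → Option (Fin n)) (f : F) => y f) ''
      {y | IsMarking (K⁻¹ * K) E y})) ≤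
      (Real.log (n * K.card) + 1) / K.card * (K * F).card := by
  have hL : (1 : ℝ) ≤ K.card := mod_cast hK.card_pos
  have hn' : (1 : ℝ) ≤ n := mod_cast hn
  have hnL : (1 : ℝ) ≤ n * K.card := one_le_mul_of_one_le_of_one_le hn' hL
  have ha := Real.log_nonneg hnL
  rw [Set.ncard_eq_toFinset_card _ (Set.toFinite _)]
  set S := (Set.toFinite ((fun (y : H → Option (Fin n)) (f : F) => y f) ''
      {y | IsMarking (K⁻¹ * K) E y})).toFinset with hS
  have key := card_sparse_le S (b := (K * F).card / K.card) ha fun f hf => by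
    obtain ⟨y, hy, rfl⟩ := (Set.Finite.mem_toFinset _).1 hf
    rw [le_div_iff₀ (by linarith), mul_comm]
    exact_mod_cast IsMarking.card_mul_card_le hy F
  rcases Nat.eq_zero_or_pos S.card with h0 | hpos
  · rw [h0, Nat.cast_zero, Real.log_zero]
    positivity
  rw [Real.log_le_iff_le_exp (mod_cast hpos)]
  refine key.trans ?_
  have h1 : (n : ℝ) * Real.exp (-Real.log (n * K.card)) = 1 / K.card := by
    rw [Real.exp_neg, Real.exp_log (by linarith)]
    field_simp
  have h2 : (F.card : ℝ) ≤ (K * F).card := mod_cast Finset.card_le_card_mul_left hK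
  have h3 : (1 + 1 / (K.card : ℝ)) ^ F.card ≤ Real.exp ((K * F).card / K.card) := by
    calc (1 + 1 / (K.card : ℝ)) ^ F.card ≤ Real.exp (1 / K.card) ^ F.card := by
          gcongr
          rw [add_comm]
          exact Real.add_one_le_exp _
      _ = Real.exp (F.card / K.card) := by
          rw [← Real.exp_nat_mul, mul_one_div]
      _ ≤ _ := by gcongr
  rw [h1, Fintype.card_coe]
  refine (mul_le_mul_of_nonneg_left h3 (Real.exp_nonneg _)).trans ?_
  rw [← Real.exp_add]
  refine le_of_eq (congrArg _ ?_)
  ring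

lemma tendsto_log_cube_div (c : ℝ) (hc : 0 < c) :
    Tendsto (fun L : ℕ => (Real.log ((L : ℝ) ^ 3 * c) + 1) / L) atTop (nhds 0) := by
  have h1 : Tendsto (fun L : ℕ => Real.log L / L) atTop (nhds 0) :=
    Real.isLittleO_log_id_atTop.tendsto_div_nhds_zero.comp tendsto_natCast_atTop_atTop
  have h2 : Tendsto (fun L : ℕ => (Real.log c + 1) / L) atTop (nhds 0) :=
    tendsto_const_div_atTop_nhds_zero_nat _
  have h3 := (h1.const_mul 3).add h2
  simp only [mul_zero, add_zero] at h3
  refine h3.congr' ?_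
  filter_upwards [eventually_gt_atTop 0] with L hL
  have : (0 : ℝ) < L := mod_cast hL
  rw [Real.log_mul (by positivity) hc.ne', Real.log_pow]
  push_cast
  ring

/-- Parameters of a level: the tile `K` and the set `E` of displacements to be told apart. -/
structure IsLevel {H : Type*} [Group H] (K E : Finset H) : Prop where
  nonempty : K.Nonempty
  inv_mem : ∀ e ∈ E, e⁻¹ ∈ E
  one_notMem : 1 ∉ E
  mem_of_ne_one : ∀ d ∈ K⁻¹ * K, d ≠ 1 → d ∈ E

lemma inv_mem_inv_mul {H : Type*} [Group H] {K : Finset H} {d : H} (hd : d ∈ K⁻¹ * K) :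
    d⁻¹ ∈ K⁻¹ * K := by
  have : (K⁻¹ * K)⁻¹ = K⁻¹ * K := by rw [mul_inv_rev, inv_inv]
  rw [← this]
  exact Finset.inv_mem_inv hd

lemma one_mem_inv_mul {H : Type*} [Group H] {K : Finset H} (hK : K.Nonempty) :
    1 ∈ K⁻¹ * K := by
  obtain ⟨k, hk⟩ := hK
  simpa using Finset.mul_mem_mul (Finset.inv_mem_inv hk) hk

lemma IsLevel.exists_isMarking {H : Type*} [Group H] [Countable H] {K E : Finset H}
    (h : IsLevel K E) : ∃ y : H → Option (Fin (E.card + 1)), IsMarking (K⁻¹ * K) E y := by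
  obtain ⟨x, hx⟩ := Countable.exists_injective_nat H
  refine ⟨_, greedy_isMarking (Nat.lt_succ_self _) (one_mem_inv_mul h.nonempty) (fun d => inv_mem_inv_mul)
    h.inv_mem h.mem_of_ne_one (x := x) fun g e he heq => h.one_notMem ?_⟩
  rwa [← mul_eq_right.1 (hx heq)]

lemma exists_next_level {H : Type*} [Group H] [Infinite H] {E : Finset H}
    (hE : ∀ e ∈ E, e⁻¹ ∈ E) (h1 : 1 ∉ E) (g : H) {η : ℝ} (hη : 0 < η) :
    ∃ K E' : Finset H, IsLevel K E' ∧ (∀ d ∈ K⁻¹ * K, ∀ e ∈ E, d * e * d⁻¹ ∈ E') ∧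
      (g ≠ 1 → g ∈ E') ∧
      (Real.log ((E'.card + 1 : ℕ) * K.card) + 1) / K.card ≤ η := by
  obtain ⟨L, hLη, hL0⟩ := (((tendsto_log_cube_div (E.card + 4) (by positivity)).eventually
    (gt_mem_nhds hη)).and (eventually_gt_atTop 0)).exists
  obtain ⟨K, hK⟩ := Infinite.exists_subset_card_eq H L
  have hKne : K.Nonempty := Finset.card_pos.1 (hK ▸ hL0)
  set D := K⁻¹ * K with hD
  have h1D : 1 ∈ D := one_mem_inv_mul hKne
  set E₀ := E ∪ ({g, g⁻¹} : Finset H).erase 1 with hE₀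
  set E' := D.erase 1 ∪ (D ×ˢ E₀).image fun p => p.1 * p.2 * p.1⁻¹ with hE'
  have hE₀inv : ∀ e ∈ E₀, e⁻¹ ∈ E₀ := by
    intro e he
    simp only [hE₀, Finset.mem_union, Finset.mem_erase, Finset.mem_insert,
      Finset.mem_singleton] at he ⊢
    rcases he with he | ⟨hne, rfl | rfl⟩
    · exact Or.inl (hE e he)
    · exact Or.inr ⟨inv_ne_one.2 hne, Or.inr rfl⟩
    · exact Or.inr ⟨inv_ne_one.2 hne, Or.inl (inv_inv g)⟩
  have hE₀1 : 1 ∉ E₀ := by simp [hE₀, h1]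
  have hconj : ∀ d ∈ D, ∀ e ∈ E₀, d * e * d⁻¹ ∈ E' := fun d hd e he =>
    Finset.mem_union_right _ (Finset.mem_image.2 ⟨(d, e), Finset.mem_product.2 ⟨hd, he⟩, rfl⟩)
  refine ⟨K, E', ⟨hKne, fun e he => ?_, fun he => ?_, fun d hd hd1 =>
    Finset.mem_union_left _ (Finset.mem_erase.2 ⟨hd1, hd⟩)⟩, fun d hd e he =>
    hconj d hd e (Finset.mem_union_left _ he), fun hg => ?_, ?_⟩
  · rcases Finset.mem_union.1 he with he | he
    · rw [Finset.mem_erase] at he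
      exact Finset.mem_union_left _ (Finset.mem_erase.2
        ⟨inv_ne_one.2 he.1, inv_mem_inv_mul he.2⟩)
    · obtain ⟨⟨d, e⟩, hde, rfl⟩ := Finset.mem_image.1 he
      rw [Finset.mem_product] at hde
      have := hconj d hde.1 _ (hE₀inv e hde.2)
      simpa [mul_assoc] using this
  · rcases Finset.mem_union.1 he with he | he
    · simp at he
    · obtain ⟨⟨d, e⟩, hde, heq⟩ := Finset.mem_image.1 he
      rw [Finset.mem_product] at hde
      have he1 : e = 1 := by simpa using heq
      exact hE₀1 (he1 ▸ hde.2)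
  · simpa using hconj 1 h1D g (Finset.mem_union_right _ (by simp [hg]))
  · have hDcard : D.card ≤ L ^ 2 := by
      refine Finset.card_mul_le.trans ?_
      rw [Finset.card_inv, hK, sq]
    have hE₀card : E₀.card ≤ E.card + 2 :=
      (Finset.card_union_le _ _).trans (Nat.add_le_add_left
        ((Finset.card_le_card (Finset.erase_subset _ _)).trans Finset.card_le_two) _)
    have hE'card : E'.card + 1 ≤ L ^ 2 * (E.card + 4) := by
      have h2 : ((D ×ˢ E₀).image fun p => p.1 * p.2 * p.1⁻¹).card ≤ L ^ 2 * (E.card + 2) :=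
        Finset.card_image_le.trans (by
          rw [Finset.card_product]
          exact Nat.mul_le_mul hDcard hE₀card)
      have h3 := Finset.card_union_le (D.erase 1)
        ((D ×ˢ E₀).image fun p => p.1 * p.2 * p.1⁻¹)
      have h4 := Finset.card_le_card (Finset.erase_subset 1 D)
      have h5 : 1 ≤ L ^ 2 := Nat.one_le_pow _ _ hL0
      rw [← hE'] at h3
      nlinarith
    rw [hK]
    refine le_trans ?_ hLη.le
    have hL : (0 : ℝ) < L := mod_cast hL0
    refine div_le_div_of_nonneg_right (add_le_add_left (Real.log_le_log (by positivity) ?_) 1) hL.le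
    calc (((E'.card + 1 : ℕ) : ℝ) * L) ≤ ((L ^ 2 * (E.card + 4) : ℕ) : ℝ) * L := by gcongr
      _ = (L : ℝ) ^ 3 * (E.card + 4) := by push_cast; ring

/-- A sequence of levels in which each level tells apart what the previous one needs, every
nontrivial displacement is eventually handled, and the complexity tends to zero. -/
lemma exists_levels (H : Type*) [Group H] [Countable H] [Infinite H] :
    ∃ K E : ℕ → Finset H, (∀ k, IsLevel (K k) (E k)) ∧
      (∀ k, ∀ d ∈ (K (k + 1))⁻¹ * K (k + 1), ∀ e ∈ E k, d * e * d⁻¹ ∈ E (k + 1)) ∧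
      (∀ g ≠ 1, ∃ k, g ∈ E k) ∧
      ∀ k : ℕ, (Real.log (((E (k + 1)).card + 1 : ℕ) * (K (k + 1)).card) + 1) / (K (k + 1)).card
        ≤ 1 / (k + 1 : ℝ) := by
  obtain ⟨g, hg⟩ := exists_surjective_nat H
  let T := {p : Finset H × Finset H // IsLevel p.1 p.2}
  have step : ∀ (k : ℕ) (p : T), ∃ q : T,
      (∀ d ∈ q.1.1⁻¹ * q.1.1, ∀ e ∈ p.1.2, d * e * d⁻¹ ∈ q.1.2) ∧ (g k ≠ 1 → g k ∈ q.1.2) ∧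
      (Real.log ((q.1.2.card + 1 : ℕ) * q.1.1.card) + 1) / q.1.1.card ≤ 1 / (k + 1 : ℝ) :=
    fun k p => by
      obtain ⟨K, E', hl, h⟩ := exists_next_level p.2.inv_mem p.2.one_notMem (g k)
        (η := 1 / (k + 1 : ℝ)) (by positivity)
      exact ⟨⟨(K, E'), hl⟩, h⟩
  choose next hnext using step
  let s : ℕ → T := fun k => Nat.rec ⟨({1}, ∅), by constructor <;> simp⟩ next k
  refine ⟨fun k => (s k).1.1, fun k => (s k).1.2, fun k => (s k).2,
    fun k => (hnext k (s k)).1, fun a ha => ?_, fun k => (hnext k (s k)).2.2⟩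
  obtain ⟨k, rfl⟩ := hg a
  exact ⟨k + 1, (hnext k (s k)).2.1 ha⟩

theorem exists_free_action (H : Type) [Group H] [Countable H] [Infinite H] :
    ∃ (X : Type) (_ : MetricSpace X) (_ : CompactSpace X) (act : H → X → X),
      Nonempty X ∧
      (∃ Bs : Set (Set X), (∀ U ∈ Bs, IsClopen U) ∧ TopologicalSpace.IsTopologicalBasis Bs) ∧
      (∀ g : H, Continuous (act g)) ∧
      (∀ x : X, act 1 x = x) ∧
      (∀ g h : H, ∀ x : X, act (g * h) x = act g (act h x)) ∧
      (∀ g : H, g ≠ 1 → ∀ x : X, act g x ≠ x) ∧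
      ∀ ε > 0, ∀ δ > 0, ∃ B : Finset H, ∀ F : Finset H, ∀ E : Finset X,
        (∀ x ∈ E, ∀ y ∈ E, x ≠ y → ∃ g ∈ F, ε < dist (act g x) (act g y)) →
          Real.log E.card ≤ δ * (B * F).card := by
  obtain ⟨K, E, hlevel, hconj, hmem, hbound⟩ := exists_levels H
  have hmap : ∀ k, ∃ Φ : (H → Option (Fin ((E (k + 1)).card + 1))) →
      H → Option (Fin ((E k).card + 1)),
      (∀ y, IsMarking ((K (k + 1))⁻¹ * K (k + 1)) (E (k + 1)) y →
        IsMarking ((K k)⁻¹ * K k) (E k) (Φ y)) ∧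
      (∃ W : Finset H, ∀ y y' h h', (∀ w ∈ W, y (w * h) = y' (w * h')) → Φ y h = Φ y' h') :=
    fun k => exists_marking_map (Nat.lt_succ_self _) (one_mem_inv_mul (hlevel k).nonempty)
      (fun d => inv_mem_inv_mul) (hlevel k).inv_mem (hlevel k).mem_of_ne_one (hconj k)
  choose Φ hΦP hΦ using hmap
  refine exists_free_action_of_levels (A := fun k => Option (Fin ((E k).card + 1)))
    (P := fun k => IsMarking ((K k)⁻¹ * K k) (E k)) (Φ := Φ) hΦP
    (fun k => (hlevel k).exists_isMarking) (fun k y => IsMarking.of_locally) hΦ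
    (fun k y g hy => hy.shift g) (fun g hg => ?_) (fun δ hδ => ?_)
  · obtain ⟨k, hk⟩ := hmem g hg
    refine ⟨k + 1, fun y hy heq => ?_⟩
    obtain ⟨d, -, hd⟩ := hy.exists_window_ne (hconj k) 1 hk
    exact hd (by simpa using congrFun heq d)
  · obtain ⟨k₀, hk₀⟩ := exists_nat_one_div_lt hδ
    refine ⟨k₀ + 1, fun k hk => ⟨K k, fun F => ?_⟩⟩
    obtain ⟨j, rfl⟩ : ∃ j, k = j + 1 := ⟨k - 1, by omega⟩
    refine (log_patterns_le (hlevel _).nonempty (Nat.succ_pos _) F).trans ?_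
    refine mul_le_mul_of_nonneg_right ((hbound j).trans (le_trans ?_ hk₀.le)) (by positivity)
    have : (k₀ : ℝ) ≤ j := by exact_mod_cast (by omega : k₀ ≤ j)
    gcongr

lemma IsFolnerSeq.eventually_card_mul_le {G : Type*} [Group G] {F : ℕ → Finset G}
    (hF : IsFolnerSeq F) (B : Finset G) :
    ∀ᶠ n in atTop, ((B * F n).card : ℝ) ≤ 2 * (F n).card := by
  have hev : ∀ᶠ n in atTop, ∀ g ∈ B,
      (((lMul g (F n)) ∆ (F n)).card : ℝ) / (F n).card < 1 / (B.card + 1) :=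
    (Filter.eventually_all_finset B).2 fun g _ =>
      (hF.2 g).eventually (gt_mem_nhds (by positivity))
  filter_upwards [hev] with n hn
  have hpos : (0 : ℝ) < (F n).card := mod_cast (hF.1 n).card_pos
  have hsub : B * F n ⊆ F n ∪ B.biUnion fun g => (lMul g (F n)) ∆ (F n) := by
    intro x hx
    obtain ⟨g, hg, f, hf, rfl⟩ := Finset.mem_mul.1 hx
    by_cases hm : g * f ∈ F n
    · exact Finset.mem_union_left _ hm
    · exact Finset.mem_union_right _ (Finset.mem_biUnion.2 ⟨g, hg, Finset.mem_symmDiff.2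
        (Or.inl ⟨Finset.mem_image_of_mem _ hf, hm⟩)⟩)
  have h1 : (B * F n).card ≤ (F n).card + ∑ g ∈ B, ((lMul g (F n)) ∆ (F n)).card :=
    (Finset.card_le_card hsub).trans ((Finset.card_union_le _ _).trans
      (Nat.add_le_add_left Finset.card_biUnion_le _))
  have h2 : ∑ g ∈ B, (((lMul g (F n)) ∆ (F n)).card : ℝ) ≤
      B.card • (1 / (B.card + 1 : ℝ) * (F n).card) :=
    Finset.sum_le_card_nsmul _ _ _ fun g hg => ((div_lt_iff₀ hpos).1 (hn g hg)).le
  have h3 : (B.card : ℝ) * (1 / (B.card + 1)) ≤ 1 := by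
    rw [mul_one_div, div_le_one (by positivity)]
    linarith
  have h4 : ((B * F n).card : ℝ) ≤ (F n).card + ∑ g ∈ B, (((lMul g (F n)) ∆ (F n)).card : ℝ) :=
    mod_cast h1
  rw [nsmul_eq_mul, ← mul_assoc] at h2
  nlinarith

/-- an infinite countable amenable group admits a free continuous action
of topological entropy zero on a compact, zero-dimensional metrizable space. Entropy is
expressed via `(F,ε)`-separated sets along any Følner sequence: `sep (F n) ε` is the
maximal cardinality of an `(F n, ε)`-separated set, and the entropy
`sup_{ε>0} limsup_n (1/|Fₙ|) log₂ sep(Fₙ,ε)` vanishes, i.e. each limsup is `≤ 0`. -/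
theorem statement16 {G : Type*} [Group G] [Countable G] [Infinite G] (hG : IsAmenable G) :
    ∃ (X : Type) (_ : MetricSpace X) (_ : CompactSpace X) (act : G → X → X),
      Nonempty X ∧
      (∃ Bs : Set (Set X), (∀ U ∈ Bs, IsClopen U) ∧
        TopologicalSpace.IsTopologicalBasis Bs) ∧
      (∀ g : G, Continuous (act g)) ∧
      (∀ x : X, act 1 x = x) ∧
      (∀ g h : G, ∀ x : X, act (g * h) x = act g (act h x)) ∧
      (∀ g : G, g ≠ 1 → ∀ x : X, act g x ≠ x) ∧
      (∀ F : ℕ → Finset G, IsFolnerSeq F → ∀ ε : ℝ, 0 < ε →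
        Filter.limsup
          (fun n =>
            Real.logb 2
              ((sSup {k : ℕ | ∃ E : Finset X, E.card = k ∧
                ∀ x ∈ E, ∀ y ∈ E, x ≠ y → ∃ g ∈ F n, ε < dist (act g x) (act g y)} : ℕ) : ℝ) /
            ((F n).card : ℝ))
          Filter.atTop ≤ 0) := by
  let φ : Shrink.{0} G ≃* G := Shrink.mulEquiv
  have : Infinite (Shrink.{0} G) := φ.toEquiv.infinite_iff.2 inferInstance
  have : Countable (Shrink.{0} G) := φ.toEquiv.countable_iff.2 inferInstance
  obtain ⟨X, hm, hc, act, hne, hB, hcont, hone, hmul, hfree, hent⟩ :=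
    exists_free_action (Shrink.{0} G)
  refine ⟨X, hm, hc, fun g => act (φ.symm g), hne, hB, fun g => hcont _, fun x => ?_,
    fun g h x => ?_, fun g hg x => hfree _ (by simpa using hg) x, fun F hF ε hε => ?_⟩
  · simp only [map_one, hone]
  · simp only [map_mul, hmul]
  refine le_of_forall_pos_le_add fun δ hδ => ?_
  rw [zero_add]
  have hlog2 : 0 < Real.log 2 := Real.log_pos one_lt_two
  obtain ⟨B, hBE⟩ := hent ε hε (δ * Real.log 2 / 2) (by positivity)
  refine Filter.limsup_le_of_le (isCoboundedUnder_le_of_le atTop (x := 0) fun n =>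
    div_nonneg (div_nonneg (Real.log_natCast_nonneg _) hlog2.le) (Nat.cast_nonneg _)) ?_
  filter_upwards [hF.eventually_card_mul_le (B.image φ)] with n hn
  have hpos : (0 : ℝ) < (F n).card := mod_cast (hF.1 n).card_pos
  rw [div_le_iff₀ hpos, Real.logb, div_le_iff₀ hlog2]
  set S : Set ℕ := {k : ℕ | ∃ E : Finset X, E.card = k ∧ ∀ x ∈ E, ∀ y ∈ E, x ≠ y →
    ∃ g ∈ F n, ε < dist (act (φ.symm g) x) (act (φ.symm g) y)} with hS
  by_cases hbdd : BddAbove S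
  · obtain ⟨E, hEcard, hE⟩ := Nat.sSup_mem (s := S) ⟨0, ∅, by simp⟩ hbdd
    rw [← hEcard]
    have hcard : B * (F n).image φ.symm = (B.image φ * F n).image φ.symm := by
      rw [Finset.image_mul, Finset.image_image]
      simp
    have hcard' : ((B * (F n).image φ.symm).card : ℝ) ≤ 2 * (F n).card := by
      rw [hcard]
      exact le_trans (mod_cast Finset.card_image_le) hn
    have := hBE ((F n).image φ.symm) E fun x hx y hy hxy => by
      obtain ⟨g, hg, hlt⟩ := hE x hx y hy hxy
      exact ⟨_, Finset.mem_image_of_mem _ hg, hlt⟩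
    refine this.trans ((mul_le_mul_of_nonneg_left hcard' (by positivity)).trans (le_of_eq ?_))
    ring
  · rw [Nat.sSup_of_not_bddAbove hbdd, Nat.cast_zero, Real.log_zero]
    positivity

end AmenableTilings
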